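/- There exist ten pairwise inequivalent extremal Type II Z_8-codes C of length 32 and type (15,1,1) each of whose binary residue codes C^{(2)} = {x mod 2 : x ∈ C} ⊆ F_2^{32} is an optimal [32,15,8] binary linear code, i.e., C^{(2)} has dimension 15 over F_2 and minimum Hamming weight 8. -/

import Mathlib

open Finset

/-- Inner product of two vectors over `ZMod N`. -/
def innerZ {N n : ℕ} (x y : Fin n → ZMod N) : ZMod N := ∑ i, x i * y i

/-- Euclidean weight of a vector over `ZMod N`. -/
def euclWt {N n : ℕ} (x : Fin n → ZMod N) : ℕ :=
  ∑ i, min ((x i).val ^ 2) ((N - (x i).val) ^ 2)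

/-- Number of coordinates of `x` equal to `a`. -/
def cntEq {N n : ℕ} (a : ZMod N) (x : Fin n → ZMod N) : ℕ :=
  (Finset.univ.filter fun j => x j = a).card

/-- A code is self-dual if it equals its dual. -/
def IsSelfDual {N n : ℕ} (C : AddSubgroup (Fin n → ZMod N)) : Prop :=
  ∀ x, x ∈ C ↔ ∀ y ∈ C, innerZ x y = 0

/-- The subcode `{v ∈ C : ⟨w, v⟩ = 0}`. -/
def evenPart {N n : ℕ} (C : AddSubgroup (Fin n → ZMod N)) (w : Fin n → ZMod N) :
    AddSubgroup (Fin n → ZMod N) where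
  carrier := {v | v ∈ C ∧ innerZ w v = 0}
  zero_mem' := ⟨C.zero_mem, by simp [innerZ]⟩
  add_mem' := by
    rintro a b ⟨ha, ha0⟩ ⟨hb, hb0⟩
    refine ⟨C.add_mem ha hb, ?_⟩
    have h : innerZ w (a + b) = innerZ w a + innerZ w b := by
      simp [innerZ, mul_add, Finset.sum_add_distrib]
    rw [h, ha0, hb0, add_zero]
  neg_mem' := by
    rintro a ⟨ha, ha0⟩
    refine ⟨C.neg_mem ha, ?_⟩
    have h : innerZ w (-a) = - innerZ w a := by
      simp [innerZ]
    rw [h, ha0, neg_zero]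

/-- `kv` extended to all of `ℕ` by zero. -/
def extk {m : ℕ} (kv : Fin m → ℕ) : ℕ → ℕ := fun t => if h : t < m then kv ⟨t, h⟩ else 0

/-- Partial sums `k_1 + ⋯ + k_j`. -/
def psum {m : ℕ} (kv : Fin m → ℕ) (j : ℕ) : ℕ := ∑ t ∈ Finset.range j, extk kv t

/-- `G` is a generator matrix in standard form of type `(k_1, …, k_m)`. -/
def StandardForm {N : ℕ} {m n : ℕ} (kv : Fin m → ℕ)
    (G : Fin (psum kv m) → Fin n → ZMod N) : Prop :=
  psum kv m ≤ n ∧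
  ∀ (j : Fin m) (r : Fin (psum kv m)), psum kv (j : ℕ) ≤ (r : ℕ) → (r : ℕ) < psum kv ((j : ℕ) + 1) →
    ∀ c : Fin n,
      (∀ l : Fin m, psum kv (l : ℕ) ≤ (c : ℕ) → (c : ℕ) < psum kv ((l : ℕ) + 1) →
        (l < j → G r c = 0) ∧
        (l = j → G r c = if (r : ℕ) = (c : ℕ) then (2 ^ (j : ℕ) : ZMod N) else 0)) ∧
      ((psum kv m ≤ (c : ℕ) ∨
        ∃ l : Fin m, j < l ∧ psum kv (l : ℕ) ≤ (c : ℕ) ∧ (c : ℕ) < psum kv ((l : ℕ) + 1)) →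
        ∃ a : ZMod N, G r c = 2 ^ (j : ℕ) * a)

/-- The minimum Euclidean weight over nonzero codewords equals `d`. -/
def minEuclWtIs {N n : ℕ} (C : AddSubgroup (Fin n → ZMod N)) (d : ℕ) : Prop :=
  (∀ x ∈ C, x ≠ 0 → d ≤ euclWt x) ∧ ∃ x ∈ C, x ≠ 0 ∧ euclWt x = d

/-- Coordinatewise reduction modulo 4. -/
def res4 {n : ℕ} : (Fin n → ZMod 8) →+ (Fin n → ZMod 4) where
  toFun := fun x i => ZMod.castHom (by norm_num : (4 : ℕ) ∣ 8) (ZMod 4) (x i)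
  map_zero' := by ext i; simp
  map_add' := by intro a b; ext i; exact map_add (ZMod.castHom (by norm_num) _) _ _

/-- Coordinatewise reduction modulo 2. -/
def res2 {n : ℕ} : (Fin n → ZMod 8) →+ (Fin n → ZMod 2) where
  toFun := fun x i => ZMod.castHom (by norm_num : (2 : ℕ) ∣ 8) (ZMod 2) (x i)
  map_zero' := by ext i; simp
  map_add' := by intro a b; ext i; exact map_add (ZMod.castHom (by norm_num) _) _ _

/-- Hamming weight of a binary vector. -/
def hammingWt {n : ℕ} (y : Fin n → ZMod 2) : ℕ :=
  (Finset.univ.filter fun i => y i ≠ 0).card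

/-- Equivalence of codes: a permutation of coordinates combined with sign changes. -/
def codeEquiv {N n : ℕ} (C C' : AddSubgroup (Fin n → ZMod N)) : Prop :=
  ∃ (σ : Equiv.Perm (Fin n)) (ε : Fin n → ZMod N),
    (∀ i, ε i = 1 ∨ ε i = -1) ∧
    ∀ y, y ∈ C' ↔ ∃ x ∈ C, y = fun i => ε i * x (σ i)

/-- The Gaussian integer `1 + i`. -/
def onePlusI : GaussianInt := ⟨1, 1⟩

/-- The Barnes–Wall lattice over the Gaussian integers in complex dimension `2 ^ n`, built by
iterating the `(u, u + (1 + i) v)` construction. Only the first `2 ^ n` coordinates of a vector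
matter. -/
def barnesWall : ℕ → AddSubgroup (ℕ → GaussianInt)
  | 0 => ⊤
  | n + 1 =>
    { carrier := {x | x ∈ barnesWall n ∧
        ∃ y ∈ barnesWall n, ∀ i < 2 ^ n, x (2 ^ n + i) = x i + onePlusI * y i}
      zero_mem' := ⟨zero_mem _, 0, zero_mem _, by simp⟩
      add_mem' := by
        rintro a b ⟨ha, u, hu, hau⟩ ⟨hb, v, hv, hbv⟩
        refine ⟨add_mem ha hb, u + v, add_mem hu hv, fun i hi => ?_⟩
        simp only [Pi.add_apply, hau i hi, hbv i hi]
        ring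
      neg_mem' := by
        rintro a ⟨ha, u, hu, hau⟩
        refine ⟨neg_mem ha, -u, neg_mem hu, fun i hi => ?_⟩
        simp only [Pi.neg_apply, hau i hi]
        ring }

/-- The standard Hermitian form on the first `2 ^ n` coordinates. -/
def herm (n : ℕ) (x y : ℕ → GaussianInt) : GaussianInt := ∑ i ∈ range (2 ^ n), x i * star (y i)

lemma herm_succ (n : ℕ) (x y : ℕ → GaussianInt) :
    herm (n + 1) x y =
      herm n x y + herm n (fun i => x (2 ^ n + i)) (fun i => y (2 ^ n + i)) := by
  simp only [herm]
  rw [pow_succ, mul_two, Finset.sum_range_add]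

lemma herm_congr {n : ℕ} {x x' y y' : ℕ → GaussianInt} (hx : ∀ i < 2 ^ n, x i = x' i)
    (hy : ∀ i < 2 ^ n, y i = y' i) : herm n x y = herm n x' y' :=
  Finset.sum_congr rfl fun i hi => by
    rw [hx i (Finset.mem_range.1 hi), hy i (Finset.mem_range.1 hi)]

lemma herm_shift (n : ℕ) (u v u' v' : ℕ → GaussianInt) :
    herm n (fun i => u i + onePlusI * v i) (fun i => u' i + onePlusI * v' i) =
      herm n u u' + star onePlusI * herm n u v' + onePlusI * herm n v u' + 2 * herm n v v' := by
  have h2 : onePlusI * star onePlusI = 2 := by decide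
  simp only [herm, Finset.mul_sum, ← Finset.sum_add_distrib, star_add, star_mul']
  refine Finset.sum_congr rfl fun i _ => ?_
  rw [← h2]
  ring

lemma herm_of_mem_succ {n : ℕ} {x u x' u' : ℕ → GaussianInt}
    (hx : ∀ i < 2 ^ n, x (2 ^ n + i) = x i + onePlusI * u i)
    (hx' : ∀ i < 2 ^ n, x' (2 ^ n + i) = x' i + onePlusI * u' i) :
    herm (n + 1) x x' =
      2 * herm n x x' + star onePlusI * herm n x u' + onePlusI * herm n u x' +
        2 * herm n u u' := by
  rw [herm_succ, herm_congr hx hx', herm_shift]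
  ring

lemma pow_dvd_herm {n : ℕ} : ∀ {x y : ℕ → GaussianInt}, x ∈ barnesWall n → y ∈ barnesWall n →
    onePlusI ^ n ∣ herm n x y := by
  induction n with
  | zero => intro x y _ _; simp
  | succ n ih =>
    rintro x y ⟨hx, u, hu, hxu⟩ ⟨hy, v, hv, hyv⟩
    have h2 : onePlusI ∣ 2 := ⟨⟨1, -1⟩, by decide⟩
    have h3 : onePlusI ∣ star onePlusI := ⟨⟨0, -1⟩, by decide⟩
    rw [herm_of_mem_succ hxu hyv, pow_succ']
    exact dvd_add (dvd_add (dvd_add (mul_dvd_mul h2 (ih hx hy)) (mul_dvd_mul h3 (ih hx hv)))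
      (mul_dvd_mul_left _ (ih hu hy))) (mul_dvd_mul h2 (ih hu hv))

lemma star_herm (n : ℕ) (x y : ℕ → GaussianInt) : star (herm n x y) = herm n y x := by
  simp only [herm, star_sum, star_mul', star_star, mul_comm]

/-- The real inner product on the first `2 ^ n` complex coordinates. -/
def realInner (n : ℕ) : (ℕ → GaussianInt) →ₗ[ℤ] (ℕ → GaussianInt) →ₗ[ℤ] ℤ :=
  LinearMap.mk₂ ℤ
    (fun x y => ∑ i ∈ range (2 ^ n), ((x i).re * (y i).re + (x i).im * (y i).im))
    (fun x x' y => by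
      rw [← Finset.sum_add_distrib]
      refine Finset.sum_congr rfl fun i _ => ?_
      simp only [Pi.add_apply, Zsqrtd.re_add, Zsqrtd.im_add]
      ring)
    (fun c x y => by
      rw [smul_eq_mul, Finset.mul_sum]
      refine Finset.sum_congr rfl fun i _ => ?_
      simp only [Pi.smul_apply, zsmul_eq_mul, Zsqrtd.re_smul, Zsqrtd.im_smul]
      ring)
    (fun x y y' => by
      rw [← Finset.sum_add_distrib]
      refine Finset.sum_congr rfl fun i _ => ?_
      simp only [Pi.add_apply, Zsqrtd.re_add, Zsqrtd.im_add]
      ring)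
    (fun c x y => by
      rw [smul_eq_mul, Finset.mul_sum]
      refine Finset.sum_congr rfl fun i _ => ?_
      simp only [Pi.smul_apply, zsmul_eq_mul, Zsqrtd.re_smul, Zsqrtd.im_smul]
      ring)

lemma realInner_apply (n : ℕ) (x y : ℕ → GaussianInt) :
    realInner n x y = ∑ i ∈ range (2 ^ n), ((x i).re * (y i).re + (x i).im * (y i).im) := rfl

lemma re_herm (n : ℕ) (x y : ℕ → GaussianInt) : (herm n x y).re = realInner n x y := by
  rw [realInner_apply, herm]
  induction range (2 ^ n) using Finset.induction_on with
  | empty => simp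
  | insert a s ha ih =>
    rw [Finset.sum_insert ha, Finset.sum_insert ha, Zsqrtd.re_add, ih]
    simp [Zsqrtd.re_mul]

lemma realInner_comm (n : ℕ) (x y : ℕ → GaussianInt) : realInner n x y = realInner n y x := by
  simp only [realInner_apply, mul_comm]

lemma realInner_self_nonneg (n : ℕ) (x : ℕ → GaussianInt) : 0 ≤ realInner n x x := by
  rw [realInner_apply]
  exact Finset.sum_nonneg fun _ _ => add_nonneg (mul_self_nonneg _) (mul_self_nonneg _)

lemma eq_zero_of_realInner_self {n : ℕ} {x : ℕ → GaussianInt} (h : realInner n x x = 0) :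
    ∀ i < 2 ^ n, x i = 0 := by
  intro i hi
  rw [realInner_apply] at h
  have h' := (Finset.sum_eq_zero_iff_of_nonneg fun i _ =>
    add_nonneg (mul_self_nonneg (x i).re) (mul_self_nonneg (x i).im)).1 h i (Finset.mem_range.2 hi)
  rw [mul_self_add_mul_self_eq_zero] at h'
  exact Zsqrtd.ext h'.1 h'.2

lemma realInner_succ (n : ℕ) (x y : ℕ → GaussianInt) :
    realInner (n + 1) x y =
      realInner n x y + realInner n (fun i => x (2 ^ n + i)) (fun i => y (2 ^ n + i)) := by
  simp only [← re_herm, herm_succ, Zsqrtd.re_add]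

lemma realInner_congr {n : ℕ} {x x' y y' : ℕ → GaussianInt} (hx : ∀ i < 2 ^ n, x i = x' i)
    (hy : ∀ i < 2 ^ n, y i = y' i) : realInner n x y = realInner n x' y' := by
  simp only [← re_herm, herm_congr hx hy]

lemma realInner_self_congr {n : ℕ} {x y : ℕ → GaussianInt} (h : ∀ i < 2 ^ n, x i = y i) :
    realInner n x x = realInner n y y :=
  realInner_congr h h

lemma realInner_self_onePlusI_mul (n : ℕ) (x : ℕ → GaussianInt) :
    realInner n (fun i => onePlusI * x i) (fun i => onePlusI * x i) = 2 * realInner n x x := by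
  simp only [realInner_apply, Finset.mul_sum, Zsqrtd.re_mul, Zsqrtd.im_mul, onePlusI]
  exact Finset.sum_congr rfl fun i _ => by ring

lemma onePlusI_mul_mem {n : ℕ} : ∀ {x : ℕ → GaussianInt}, x ∈ barnesWall n →
    (fun i => onePlusI * x i) ∈ barnesWall n := by
  induction n with
  | zero => exact fun _ => trivial
  | succ n ih =>
    rintro x ⟨hx, u, hu, hxu⟩
    exact ⟨ih hx, _, ih hu, fun i hi => by simp only [hxu i hi, mul_add]⟩

/-- The minimum norm of the lattice `barnesWall n` is at least `2 ^ n`. -/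
lemma le_realInner_self {n : ℕ} : ∀ {x : ℕ → GaussianInt}, x ∈ barnesWall n →
    realInner n x x ≠ 0 → 2 ^ n ≤ realInner n x x := by
  induction n with
  | zero =>
    intro x _ h
    have := realInner_self_nonneg 0 x
    simp only [pow_zero]
    omega
  | succ n ih =>
    rintro x ⟨hx, u, hu, hxu⟩ h0
    rw [realInner_succ, realInner_self_congr hxu] at h0 ⊢
    have hw := add_mem hx (onePlusI_mul_mem hu)
    set w : ℕ → GaussianInt := x + fun i => onePlusI * u i with hw_def
    change realInner n x x + realInner n w w ≠ 0 at h0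
    change 2 ^ (n + 1) ≤ realInner n x x + realInner n w w
    have hu2 := realInner_self_onePlusI_mul n u
    rw [pow_succ]
    by_cases hx0 : realInner n x x = 0
    · have hwu : realInner n w w = 2 * realInner n u u := by
        rw [← hu2]
        refine realInner_self_congr fun i hi => ?_
        simp [hw_def, eq_zero_of_realInner_self hx0 i hi]
      have := ih hu (by omega)
      omega
    · have hx1 := ih hx hx0
      by_cases hw0 : realInner n w w = 0
      · have hxu' : realInner n x x = 2 * realInner n u u := by
          have hneg : realInner n x x = realInner n (-x) (-x) := by simp
          rw [← hu2, hneg]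
          refine realInner_self_congr fun i hi => ?_
          have := eq_zero_of_realInner_self hw0 i hi
          simp only [hw_def, Pi.add_apply] at this
          simpa [neg_eq_iff_add_eq_zero] using this
        have := ih hu (by omega)
        omega
      · have := ih hw hw0
        omega

lemma onePlusI_pow_four : onePlusI ^ 4 = ((-4 : ℤ) : GaussianInt) := by decide

lemma four_dvd_realInner {x y : ℕ → GaussianInt} (hx : x ∈ barnesWall 4)
    (hy : y ∈ barnesWall 4) : 4 ∣ realInner 4 x y := by
  obtain ⟨c, hc⟩ := pow_dvd_herm hx hy
  rw [← re_herm, hc, onePlusI_pow_four, Zsqrtd.re_smul]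
  exact ⟨-c.re, by ring⟩

lemma eight_dvd_realInner_self {x : ℕ → GaussianInt} (hx : x ∈ barnesWall 4) :
    8 ∣ realInner 4 x x := by
  obtain ⟨hx, u, hu, hxu⟩ := hx
  obtain ⟨c, hc⟩ := pow_dvd_herm hu hx
  have h1 : onePlusI * herm 3 u x = ((-4 : ℤ) : GaussianInt) * c := by
    rw [hc, ← mul_assoc, ← pow_succ', onePlusI_pow_four]
  have h2 : star onePlusI * herm 3 x u = star (((-4 : ℤ) : GaussianInt) * c) := by
    rw [← h1, star_mul', star_herm]
  have h4 : ∀ {y : ℕ → GaussianInt}, y ∈ barnesWall 3 → 4 ∣ (herm 3 y y).re := by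
    intro y hy
    obtain ⟨d, hd⟩ := pow_dvd_herm hy hy
    have h3 : onePlusI ^ 3 = ⟨-2, 2⟩ := by decide
    have him : (herm 3 y y).im = 0 := by
      have := congrArg Zsqrtd.im (star_herm 3 y y)
      rw [Zsqrtd.im_star] at this
      omega
    rw [hd, h3, Zsqrtd.im_mul] at him
    rw [hd, h3, Zsqrtd.re_mul]
    dsimp only at him ⊢
    omega
  have h5 := h4 hx
  have h6 := h4 hu
  have htwo : (2 : GaussianInt) = ((2 : ℤ) : GaussianInt) := rfl
  rw [← re_herm, herm_of_mem_succ hxu hxu, h1, h2, htwo]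
  simp only [Zsqrtd.re_add, Zsqrtd.re_smul, Zsqrtd.re_star]
  omega

section Coding

lemma sq_valMinAbs_eq : ∀ a : ZMod 8,
    ((min (a.val ^ 2) ((8 - a.val) ^ 2) : ℕ) : ℤ) = a.valMinAbs ^ 2 := by decide

lemma euclWt_eq {n : ℕ} (x : Fin n → ZMod 8) :
    (euclWt x : ℤ) = ∑ i, (x i).valMinAbs ^ 2 := by
  rw [euclWt, Nat.cast_sum]
  exact Finset.sum_congr rfl fun i _ => sq_valMinAbs_eq (x i)

lemma innerZ_comm {N n : ℕ} (x y : Fin n → ZMod N) : innerZ x y = innerZ y x := by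
  simp only [innerZ, mul_comm]

/-- The inner product with a fixed vector as an additive homomorphism. -/
def innerHom {N n : ℕ} (x : Fin n → ZMod N) : (Fin n → ZMod N) →+ ZMod N where
  toFun := innerZ x
  map_zero' := by simp [innerZ]
  map_add' y z := by simp [innerZ, mul_add, Finset.sum_add_distrib]

lemma sum_addChar_comp {N : ℕ} [NeZero N] {A : Type*} [AddCommGroup A] [Fintype A]
    (f : A →+ ZMod N) [Decidable (∀ a, f a = 0)] :
    ∑ a, ZMod.stdAddChar (f a) = if ∀ a, f a = 0 then (Fintype.card A : ℂ) else 0 := by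
  split_ifs with h
  · simp [h]
  · have hne : ZMod.stdAddChar.compAddMonoidHom f ≠ 0 := by
      push Not at h
      obtain ⟨a, ha⟩ := h
      refine AddChar.ne_zero_iff.2 ⟨a, fun h1 => ha (ZMod.injective_stdAddChar ?_)⟩
      simpa using h1
    exact AddChar.sum_eq_zero_iff_ne_zero.2 hne

/-- The dual of a code. -/
def dualCode {N n : ℕ} (C : AddSubgroup (Fin n → ZMod N)) : AddSubgroup (Fin n → ZMod N) where
  carrier := {x | ∀ y ∈ C, innerZ y x = 0}
  zero_mem' y _ := map_zero (innerHom y)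
  add_mem' ha hb y hy :=
    (map_add (innerHom y) _ _).trans ((congrArg₂ _ (ha y hy) (hb y hy)).trans (add_zero 0))
  neg_mem' ha y hy := (map_neg (innerHom y) _).trans ((congrArg _ (ha y hy)).trans neg_zero)

lemma mem_dualCode {N n : ℕ} {C : AddSubgroup (Fin n → ZMod N)} {x : Fin n → ZMod N} :
    x ∈ dualCode C ↔ ∀ y ∈ C, innerZ x y = 0 := by
  simp only [innerZ_comm x]
  rfl

lemma card_mul_card_dualCode {N n : ℕ} [NeZero N] (C : AddSubgroup (Fin n → ZMod N)) :
    Nat.card C * Nat.card (dualCode C) = N ^ n := by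
  classical
  have h1 : ∀ x : Fin n → ZMod N, ∑ y : C, ZMod.stdAddChar (innerZ x (y : Fin n → ZMod N)) =
      if x ∈ dualCode C then (Nat.card C : ℂ) else 0 := by
    intro x
    have := sum_addChar_comp ((innerHom x).comp C.subtype)
    simp only [AddMonoidHom.comp_apply, AddSubgroup.coe_subtype] at this
    refine this.trans ?_
    rw [Nat.card_eq_fintype_card]
    refine if_congr ?_ rfl rfl
    rw [mem_dualCode]
    exact ⟨fun h y hy => h ⟨y, hy⟩, fun h y => h y y.2⟩
  have h2 : ∀ y : C, ∑ x : Fin n → ZMod N, ZMod.stdAddChar (innerZ x (y : Fin n → ZMod N)) =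
      if y = 0 then (N ^ n : ℂ) else 0 := by
    intro y
    simp only [innerZ_comm _ (y : Fin n → ZMod N)]
    refine (sum_addChar_comp (innerHom (y : Fin n → ZMod N))).trans ?_
    refine if_congr ⟨fun h => ?_, fun h x => ?_⟩ (by simp [ZMod.card]) rfl
    · ext i
      have hi : innerZ (y : Fin n → ZMod N) (Pi.single i 1) = 0 := h (Pi.single i 1)
      simpa [innerZ, Pi.single_apply] using hi
    · simp [h, innerHom, innerZ]
  have h3 := Finset.sum_comm (s := (Finset.univ : Finset (Fin n → ZMod N)))
    (t := (Finset.univ : Finset C))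
    (f := fun x y => ZMod.stdAddChar (innerZ x (y : Fin n → ZMod N)))
  simp only [h1, h2, Finset.sum_ite_eq', Finset.mem_univ, if_true] at h3
  rw [Finset.sum_ite, Finset.sum_const_zero, add_zero, Finset.sum_const, nsmul_eq_mul] at h3
  have h4 : (Finset.univ.filter fun x => x ∈ dualCode C).card = Nat.card (dualCode C) := by
    rw [Nat.card_eq_fintype_card, Fintype.card_subtype]
  rw [h4, mul_comm] at h3
  exact_mod_cast h3

lemma isSelfDual_of_card {N n : ℕ} [NeZero N] {C : AddSubgroup (Fin n → ZMod N)}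
    (horth : ∀ x ∈ C, ∀ y ∈ C, innerZ x y = 0) (hcard : Nat.card C * Nat.card C = N ^ n) :
    IsSelfDual C := by
  have hle : C ≤ dualCode C := fun x hx => mem_dualCode.2 (horth x hx)
  have hpos : 0 < Nat.card C := Nat.card_pos
  have heq : C = dualCode C := AddSubgroup.eq_of_le_of_card_ge hle
    (Nat.eq_of_mul_eq_mul_left hpos ((card_mul_card_dualCode C).trans hcard.symm)).le
  intro x
  rw [← mem_dualCode, ← heq]

/-- The vector with entries `4` on `S` and `0` elsewhere. -/
def fourOn {n : ℕ} (S : Finset (Fin n)) : Fin n → ZMod 8 := fun i => if i ∈ S then 4 else 0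

open Classical in
/-- The number of codewords with exactly `k` entries `4` and all other entries `0`. -/
noncomputable def fourCount {n : ℕ} (k : ℕ) (C : AddSubgroup (Fin n → ZMod 8)) : ℕ :=
  #{S ∈ powersetCard k univ | fourOn S ∈ C}

lemma fourCount_eq_of_codeEquiv {n : ℕ} {C C' : AddSubgroup (Fin n → ZMod 8)}
    (h : codeEquiv C C') (k : ℕ) : fourCount k C = fourCount k C' := by
  classical
  obtain ⟨σ, ε, hε, h⟩ := h
  have hmem : ∀ S, fourOn S ∈ C ↔ fourOn (S.map σ.symm.toEmbedding) ∈ C' := by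
    intro S
    have key : ∀ i, fourOn (S.map σ.symm.toEmbedding) i = fourOn S (σ i) := by
      intro i
      simp [fourOn, Finset.mem_map_equiv]
    have hsign : ∀ i, ∀ a : ZMod 8, ε i * a = fourOn S (σ i) ↔ a = fourOn S (σ i) := by
      intro i a
      have hd : ∀ b : ZMod 8, (b = 4 ∨ b = 0) → ∀ e : ZMod 8, (e = 1 ∨ e = -1) →
        (e * a = b ↔ a = b) := by decide +revert
      refine hd _ ?_ _ (hε i)
      unfold fourOn
      split_ifs <;> simp
    rw [h]
    constructor
    · intro hS
      exact ⟨_, hS, funext fun i => by rw [key, (hsign i _).2 rfl]⟩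
    · rintro ⟨x, hx, hxe⟩
      have : x = fourOn S := by
        ext i
        have := congrFun hxe (σ.symm i)
        rw [key] at this
        simpa using (hsign _ _).1 this.symm
      exact this ▸ hx
  unfold fourCount
  refine Finset.card_bij (fun S _ => S.map σ.symm.toEmbedding) ?_ ?_ ?_
  · intro S hS
    simp only [Finset.mem_filter, Finset.mem_powersetCard_univ, Finset.card_map] at hS ⊢
    exact ⟨hS.1, (hmem S).1 hS.2⟩
  · intro S _ T _ hST
    exact Finset.map_injective _ hST
  · intro T hT
    have hTT : (T.map σ.toEmbedding).map σ.symm.toEmbedding = T := by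
      ext i
      simp [Finset.mem_map_equiv]
    refine ⟨T.map σ.toEmbedding, ?_, hTT⟩
    simp only [Finset.mem_filter, Finset.mem_powersetCard_univ, Finset.card_map] at hT ⊢
    exact ⟨hT.1, (hmem _).2 (hTT.symm ▸ hT.2)⟩

end Coding

/-- The number of ways to choose `k` entries of `L` whose exclusive or with `s` satisfies `p`.
Defined by recursors for efficient evaluation in the kernel. -/
def xorCount (p : ℕ → Bool) (k : ℕ) : List ℕ → ℕ → ℕ :=
  Nat.rec (fun _ s => bif p s then 1 else 0)
    (fun _ f L => List.rec (fun _ => 0) (fun a L g s => Nat.add (f L (Nat.xor s a)) (g s)) L) k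

lemma xorCount_zero (p : ℕ → Bool) (L : List ℕ) (s : ℕ) :
    xorCount p 0 L s = bif p s then 1 else 0 := rfl

lemma xorCount_nil (p : ℕ → Bool) (k s : ℕ) : xorCount p (k + 1) [] s = 0 := rfl

lemma xorCount_cons (p : ℕ → Bool) (k a : ℕ) (L : List ℕ) (s : ℕ) :
    xorCount p (k + 1) (a :: L) s = xorCount p k L (s ^^^ a) + xorCount p (k + 1) L s := rfl

/-- The exclusive or of the values of `h` on `S`. -/
def xorOn {ι : Type*} (h : ι → ℕ) (S : Finset ι) : ℕ := S.fold (· ^^^ ·) 0 h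

lemma xorCount_map {ι : Type*} [DecidableEq ι] (p : ℕ → Bool) (h : ι → ℕ) :
    ∀ (k : ℕ) (l : List ι) (s : ℕ), l.Nodup →
      xorCount p k (l.map h) s = #{S ∈ powersetCard k l.toFinset | p (s ^^^ xorOn h S)}
  | 0, l, s, _ => by
    cases hp : p s <;> simp [xorCount_zero, xorOn, Finset.filter_singleton, hp]
  | k + 1, [], s, _ => by
    rw [List.map_nil, xorCount_nil, List.toFinset_nil, Finset.powersetCard_eq_empty.2 (by simp)]
    simp
  | k + 1, a :: l, s, hl => by
    obtain ⟨hal, hl⟩ := List.nodup_cons.1 hl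
    have ha : a ∉ l.toFinset := by simpa using hal
    rw [List.map_cons, xorCount_cons, xorCount_map p h k l _ hl, xorCount_map p h (k + 1) l _ hl,
      List.toFinset_cons, Finset.powersetCard_succ_insert ha, Finset.filter_union,
      Finset.card_union_of_disjoint, add_comm, Finset.filter_image, Finset.card_image_of_injOn]
    · congr 2
      refine Finset.filter_congr fun S hS => ?_
      have haS : a ∉ S := fun h' => ha ((Finset.mem_powersetCard.1 hS).1 h')
      simp only [xorOn, Finset.fold_insert haS, Nat.xor_assoc]
    · intro S hS T hT hST
      have haS : a ∉ S := fun h' =>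
        ha ((Finset.mem_powersetCard.1 (Finset.mem_filter.1 hS).1).1 h')
      have haT : a ∉ T := fun h' =>
        ha ((Finset.mem_powersetCard.1 (Finset.mem_filter.1 hT).1).1 h')
      rw [← Finset.erase_insert haS, ← Finset.erase_insert haT]
      exact congrArg (Finset.erase · a) hST
    · refine Finset.disjoint_left.2 fun S hS hS' => ?_
      obtain ⟨T, _, rfl⟩ := Finset.mem_image.1 (Finset.mem_filter.1 hS').1
      exact ha ((Finset.mem_powersetCard.1 (Finset.mem_filter.1 hS).1).1
        (Finset.mem_insert_self a T))

lemma testBit_xorOn {ι : Type*} [DecidableEq ι] (h : ι → ℕ) (r : ι → ℤ) (k : ℕ)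
    (hr : ∀ i, (h i).testBit k = decide (r i % 2 = 1)) (S : Finset ι) :
    (xorOn h S).testBit k = decide ((∑ i ∈ S, r i) % 2 = 1) := by
  induction S using Finset.induction_on with
  | empty => simp [xorOn]
  | insert a S ha ih =>
    rw [xorOn, Finset.fold_insert ha, ← xorOn, Nat.testBit_xor, ih, hr, Finset.sum_insert ha]
    by_cases h1 : r a % 2 = 1 <;> by_cases h2 : (∑ i ∈ S, r i) % 2 = 1 <;>
      simp [h1, h2] <;> omega

lemma xorOn_lt {ι : Type*} [DecidableEq ι] {h : ι → ℕ} {k : ℕ} (hr : ∀ i, h i < 2 ^ k)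
    (S : Finset ι) : xorOn h S < 2 ^ k := by
  induction S using Finset.induction_on with
  | empty => simp [xorOn]
  | insert a S ha ih =>
    rw [xorOn, Finset.fold_insert ha]
    exact Nat.xor_lt_two_pow (hr a) ih

/-- Entry `j` of row `i` of an integer matrix whose rows are given by numbers in base `16`, the
digit `m` standing for the entry `m - 8`, least significant digit first. -/
def entry (L : List ℕ) (i j : ℕ) : ℤ := ((L.getD i 0 / 16 ^ j % 16 : ℕ) : ℤ) - 8

/-- The vector of Gaussian integers whose real and imaginary parts are given by row `i`. -/
def gaussRow (L : List ℕ) (i : ℕ) : ℕ → GaussianInt :=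
  fun j => ⟨entry L i (2 * j), entry L i (2 * j + 1)⟩

/-- The multiplicities of the rows of a generator matrix of type `(15, 1, 1)`. -/
def rowMult (k : ℕ) : ℤ := if k < 15 then 1 else if k = 15 then 2 else 4

/-- A membership test for `barnesWall`, on vectors given by their real and imaginary parts. -/
def inBarnesWall : ℕ → (ℕ → ℤ) → (ℕ → ℤ) → Bool
  | 0, _, _ => true
  | n + 1, a, b =>
    inBarnesWall n a b &&
    (List.range (2 ^ n)).all (fun i => (a (2 ^ n + i) - a i + (b (2 ^ n + i) - b i)) % 2 == 0) &&
    inBarnesWall n (fun i => (a (2 ^ n + i) - a i + (b (2 ^ n + i) - b i)) / 2)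
      (fun i => (b (2 ^ n + i) - b i - (a (2 ^ n + i) - a i)) / 2)

lemma mem_barnesWall_of_inBarnesWall : ∀ {n : ℕ} {a b : ℕ → ℤ}, inBarnesWall n a b = true →
    (fun i => (⟨a i, b i⟩ : GaussianInt)) ∈ barnesWall n
  | 0, _, _, _ => trivial
  | n + 1, a, b, h => by
    simp only [inBarnesWall, Bool.and_eq_true, List.all_eq_true, List.mem_range, beq_iff_eq] at h
    obtain ⟨⟨h1, h2⟩, h3⟩ := h
    refine ⟨mem_barnesWall_of_inBarnesWall h1, _, mem_barnesWall_of_inBarnesWall h3, ?_⟩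
    intro i hi
    have := h2 i hi
    ext <;> simp only [onePlusI, Zsqrtd.re_add, Zsqrtd.im_add, Zsqrtd.re_mul, Zsqrtd.im_mul] <;>
      omega

/-- The data describing a code: an orthogonal frame of vectors of `barnesWall 4`, a generator
matrix of the code (with the last two rows divided by `2` and `4`), the lattice vectors
represented by the generators, and the columns of the generator matrix modulo `2`. -/
structure CodeData where
  frame : List ℕ
  gens : List ℕ
  lifts : List ℕ
  cols : List ℕ

/-- The properties of `CodeData` that have to be checked by computation. -/
structure CodeData.Valid (d : CodeData) (n₃ n₄ : ℕ) : Prop where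
  frame_orth : ∀ i < 32, ∀ j < i + 1,
    ∑ l ∈ range 16, (entry d.frame i (2 * l) * entry d.frame j (2 * l) +
      entry d.frame i (2 * l + 1) * entry d.frame j (2 * l + 1)) = if i = j then 32 else 0
  frame_mem : ∀ i < 32, inBarnesWall 4 (fun l => entry d.frame i (2 * l))
    (fun l => entry d.frame i (2 * l + 1)) = true
  lifts_mem : ∀ k < 17, inBarnesWall 4 (fun l => entry d.lifts k (2 * l))
    (fun l => entry d.lifts k (2 * l + 1)) = true
  lifts_eq : ∀ k < 17, ∀ l < 32,
    ∑ i ∈ range 32, rowMult k * entry d.gens k i * entry d.frame i l = 8 * entry d.lifts k l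
  pivot : ∀ k < 15, ∀ j < 15, entry d.gens k j = if k = j then 1 else 0
  pivot_two : ∀ j < 16, entry d.gens 15 j = if j = 15 then 1 else 0
  pivot_four : ∀ j < 17, entry d.gens 16 j = if j = 16 then 1 else 0
  cols_lt : ∀ i < 32, d.cols.getD i 0 < 2 ^ 17
  cols_length : d.cols.length = 32
  testBit_cols : ∀ k < 17, ∀ i < 32,
    (d.cols.getD i 0).testBit k = decide (entry d.gens k i % 2 = 1)
  abs_le : ∀ i < 32, -4 < entry d.gens 0 i ∧ entry d.gens 0 i ≤ 4
  norm_first : ∑ i ∈ range 32, entry d.gens 0 i ^ 2 = 32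
  weight_first : ∑ i ∈ range 32, entry d.gens 0 i % 2 = 8
  count_min : xorCount (fun s => Nat.beq s 0) 4 d.cols 0 = 0
  count_three : xorCount (fun s => Nat.beq (s.mod 32768) 0) 3 d.cols 0 = n₃
  count_four : xorCount (fun s => Nat.beq (s.mod 32768) 0) 4 d.cols 0 = n₄

/-- Multiplication by `2` as a homomorphism from `ZMod 4` to `ZMod 8`. -/
def twoMul : ZMod 4 →+ ZMod 8 where
  toFun b := b.val * 2
  map_zero' := rfl
  map_add' := by decide

/-- Multiplication by `4` as a homomorphism from `ZMod 2` to `ZMod 8`. -/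
def fourMul : ZMod 2 →+ ZMod 8 where
  toFun b := b.val * 4
  map_zero' := rfl
  map_add' := by decide

lemma hammingWt_res2 {n : ℕ} (x : Fin n → ZMod 8) :
    hammingWt (res2 x) = #{i | (x i).valMinAbs % 2 = 1} := by
  have key : ∀ a : ZMod 8, ZMod.castHom (by norm_num : 2 ∣ 8) (ZMod 2) a ≠ 0 ↔
      a.valMinAbs % 2 = 1 := by decide
  exact congrArg Finset.card (Finset.filter_congr fun i _ => key (x i))

lemma sum_filter_odd_mod_two {n : ℕ} (t r : Fin n → ℤ) :
    (∑ i with t i % 2 = 1, r i) % 2 = (∑ i, t i * r i) % 2 := by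
  rw [Finset.sum_filter, ← Int.ModEq, Int.modEq_iff_dvd, ← Finset.sum_sub_distrib]
  refine Finset.dvd_sum fun i _ => ?_
  rcases Int.even_or_odd' (t i) with ⟨m, hm | hm⟩
  · rw [hm, if_neg (by omega)]
    exact ⟨m * r i, by ring⟩
  · rw [hm, if_pos (by omega)]
    exact ⟨m * r i, by ring⟩

namespace CodeData

/-- Row `k` of the generator matrix over the integers. -/
def row (d : CodeData) (k : ℕ) (i : Fin 32) : ℤ := rowMult k * entry d.gens k i

/-- Row `k` of the generator matrix. -/
def gen (d : CodeData) (k : ℕ) (i : Fin 32) : ZMod 8 := (d.row k i : ZMod 8)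

/-- The parametrization of the code by its generator matrix. -/
def hom (d : CodeData) : (Fin 15 → ZMod 8) × ZMod 4 × ZMod 2 →+ (Fin 32 → ZMod 8) where
  toFun a i := ∑ k, a.1 k * (entry d.gens k i : ZMod 8) +
    twoMul a.2.1 * (entry d.gens 15 i : ZMod 8) + fourMul a.2.2 * (entry d.gens 16 i : ZMod 8)
  map_zero' := by ext i; simp
  map_add' a b := by
    ext i
    simp only [Prod.fst_add, Prod.snd_add, Pi.add_apply, map_add, add_mul,
      Finset.sum_add_distrib]
    ring

/-- The code described by `d`. -/
def code (d : CodeData) : AddSubgroup (Fin 32 → ZMod 8) := d.hom.range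

lemma hom_apply (d : CodeData) (a : (Fin 15 → ZMod 8) × ZMod 4 × ZMod 2) (i : Fin 32) :
    d.hom a i = ∑ k, a.1 k * (entry d.gens k i : ZMod 8) +
      twoMul a.2.1 * (entry d.gens 15 i : ZMod 8) +
      fourMul a.2.2 * (entry d.gens 16 i : ZMod 8) := rfl

lemma row_zero (d : CodeData) (i : Fin 32) : d.row 0 i = entry d.gens 0 i := by
  simp [row, rowMult]

lemma gen_mem (d : CodeData) {k : ℕ} (hk : k < 17) : d.gen k ∈ d.code := by
  have h2 : twoMul 1 = 2 := rfl
  have h4 : fourMul 1 = 4 := rfl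
  rcases (by omega : k < 15 ∨ k = 15 ∨ k = 16) with hk | rfl | rfl
  · refine ⟨(Pi.single ⟨k, hk⟩ 1, 0, 0), ?_⟩
    ext i
    simp [hom_apply, gen, row, rowMult, hk, Pi.single_apply]
  · refine ⟨(0, 1, 0), ?_⟩
    ext i
    simp [hom_apply, gen, row, rowMult, h2]
  · refine ⟨(0, 0, 1), ?_⟩
    ext i
    simp [hom_apply, gen, row, rowMult, h4]

lemma code_le (d : CodeData) {S : AddSubgroup (Fin 32 → ZMod 8)}
    (h : ∀ k < 17, d.gen k ∈ S) : d.code ≤ S := by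
  rintro _ ⟨⟨a, b, c⟩, rfl⟩
  have : d.hom (a, b, c) =
      ∑ k : Fin 15, (a k).val • d.gen k + b.val • d.gen 15 + c.val • d.gen 16 := by
    ext i
    have h2 : twoMul b = b.val * 2 := rfl
    have h4 : fourMul c = c.val * 4 := rfl
    simp only [Pi.add_apply, Finset.sum_apply, Pi.smul_apply, hom_apply, h2, h4]
    simp [gen, row, rowMult, mul_assoc]
  rw [this]
  exact add_mem (add_mem (sum_mem fun k _ => nsmul_mem (h k (by omega)) _)
    (nsmul_mem (h 15 (by norm_num)) _)) (nsmul_mem (h 16 (by norm_num)) _)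

/-- The integral combination of the frame vectors with the given coefficients. -/
def frameSum (d : CodeData) (t : Fin 32 → ℤ) : ℕ → GaussianInt :=
  ∑ i : Fin 32, t i • gaussRow d.frame i

lemma frameSum_add (d : CodeData) (s t : Fin 32 → ℤ) :
    d.frameSum (s + t) = d.frameSum s + d.frameSum t := by
  simp only [frameSum, Pi.add_apply, add_smul, Finset.sum_add_distrib]

lemma frameSum_smul (d : CodeData) (c : ℤ) (t : Fin 32 → ℤ) :
    d.frameSum (c • t) = c • d.frameSum t := by
  simp only [frameSum, Pi.smul_apply, smul_eq_mul, mul_smul, Finset.smul_sum]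

/-- The vectors over `ZMod 8` whose integral lifts give frame combinations in
`8 • barnesWall 4`. -/
def latticeCode (d : CodeData) : AddSubgroup (Fin 32 → ZMod 8) where
  carrier := {x | ∃ t : Fin 32 → ℤ, (∀ i, (t i : ZMod 8) = x i) ∧
    ∃ v ∈ barnesWall 4, ∀ j < 16, ((8 : ℤ) • v) j = d.frameSum t j}
  zero_mem' := ⟨0, by simp, 0, zero_mem _, by simp [frameSum]⟩
  add_mem' := by
    rintro x y ⟨s, hs, u, hu, hus⟩ ⟨t, ht, v, hv, hvt⟩
    refine ⟨s + t, by simp [hs, ht], u + v, add_mem hu hv, fun j hj => ?_⟩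
    rw [frameSum_add, smul_add, Pi.add_apply, Pi.add_apply, hus j hj, hvt j hj]
  neg_mem' := by
    rintro x ⟨s, hs, u, hu, hus⟩
    refine ⟨(-1 : ℤ) • s, by simp [hs], -u, neg_mem hu, fun j hj => ?_⟩
    rw [frameSum_smul, smul_neg, Pi.neg_apply, hus j hj]
    simp

namespace Valid

variable {d : CodeData} {n₃ n₄ : ℕ}

lemma hom_injective (h : d.Valid n₃ n₄) : Function.Injective d.hom := by
  rw [injective_iff_map_eq_zero]
  rintro ⟨a, b, c⟩ h0
  have ha : a = 0 := by
    ext j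
    have hj := congrFun h0 (Fin.castLE (by norm_num) j)
    simp only [hom_apply, Fin.val_castLE, h.pivot_two j (by omega), h.pivot_four j (by omega),
      h.pivot _ (Fin.is_lt _) _ j.2, Fin.val_inj] at hj
    simpa [j.2.ne, (j.2.trans (Nat.lt_succ_self 15)).ne] using hj
  subst ha
  have hb : b = 0 := by
    have hb := congrFun h0 15
    have h15 : ((15 : Fin 32) : ℕ) = 15 := rfl
    simp only [hom_apply, h15, h.pivot_two 15 (by norm_num), h.pivot_four 15 (by norm_num)] at hb
    have key : ∀ b, twoMul b = 0 → b = 0 := by decide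
    exact key b (by simpa using hb)
  subst hb
  have hc := congrFun h0 16
  have h16 : ((16 : Fin 32) : ℕ) = 16 := rfl
  simp only [hom_apply, h16, h.pivot_four 16 (by norm_num)] at hc
  have key : ∀ c, fourMul c = 0 → c = 0 := by decide
  have := key c (by simpa using hc)
  rw [this]
  rfl

/-- A code of type `(15, 1, 1)`. -/
noncomputable def codeEquivProd (h : d.Valid n₃ n₄) :
    d.code ≃+ ((Fin 15 → ZMod 8) × ZMod 4 × ZMod 2) :=
  (AddMonoidHom.ofInjective h.hom_injective).symm

lemma card_code (h : d.Valid n₃ n₄) : Nat.card d.code = 8 ^ 16 := by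
  rw [Nat.card_congr h.codeEquivProd.toEquiv]
  simp

lemma gaussRow_mem (h : d.Valid n₃ n₄) {i : ℕ} (hi : i < 32) :
    gaussRow d.frame i ∈ barnesWall 4 :=
  mem_barnesWall_of_inBarnesWall (h.frame_mem i hi)

lemma frameSum_mem (h : d.Valid n₃ n₄) (t : Fin 32 → ℤ) : d.frameSum t ∈ barnesWall 4 :=
  sum_mem fun i _ => zsmul_mem (h.gaussRow_mem i.2) _

lemma realInner_gaussRow (h : d.Valid n₃ n₄) (i j : Fin 32) :
    realInner 4 (gaussRow d.frame i) (gaussRow d.frame j) = if i = j then 32 else 0 := by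
  rcases le_total (j : ℕ) i with hij | hij
  · exact (h.frame_orth i i.2 j (by omega)).trans (if_congr Fin.val_inj rfl rfl)
  · rw [realInner_comm]
    exact (h.frame_orth j j.2 i (by omega)).trans (if_congr (Fin.val_inj.trans eq_comm) rfl rfl)

lemma realInner_frameSum (h : d.Valid n₃ n₄) (s t : Fin 32 → ℤ) :
    realInner 4 (d.frameSum s) (d.frameSum t) = 32 * ∑ i, s i * t i := by
  simp only [frameSum, map_sum, map_smul, LinearMap.sum_apply, LinearMap.smul_apply,
    h.realInner_gaussRow, smul_eq_mul, mul_ite, mul_zero,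
    Finset.sum_ite_eq', Finset.mem_univ, if_true, Finset.mul_sum]
  exact Finset.sum_congr rfl fun i _ => by ring

lemma code_le_latticeCode (h : d.Valid n₃ n₄) : d.code ≤ d.latticeCode := by
  refine d.code_le fun k hk => ⟨d.row k, fun i => rfl, gaussRow d.lifts k,
    mem_barnesWall_of_inBarnesWall (h.lifts_mem k hk), fun j hj => ?_⟩
  have h1 := h.lifts_eq k hk (2 * j) (by omega)
  have h2 := h.lifts_eq k hk (2 * j + 1) (by omega)
  rw [Finset.sum_range] at h1 h2
  have hre : ∀ (s : Finset (Fin 32)) (f : Fin 32 → GaussianInt),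
      (∑ i ∈ s, f i).re = ∑ i ∈ s, (f i).re := fun s f =>
    map_sum (⟨⟨Zsqrtd.re, rfl⟩, fun _ _ => rfl⟩ : GaussianInt →+ ℤ) f s
  have him : ∀ (s : Finset (Fin 32)) (f : Fin 32 → GaussianInt),
      (∑ i ∈ s, f i).im = ∑ i ∈ s, (f i).im := fun s f =>
    map_sum (⟨⟨Zsqrtd.im, rfl⟩, fun _ _ => rfl⟩ : GaussianInt →+ ℤ) f s
  rw [frameSum, Finset.sum_apply]
  ext
  · simpa [hre, gaussRow, row] using h1.symm
  · simpa [him, gaussRow, row] using h2.symm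

lemma exists_lattice_vector (h : d.Valid n₃ n₄) {x : Fin 32 → ZMod 8} (hx : x ∈ d.code)
    {t : Fin 32 → ℤ} (ht : ∀ i, (t i : ZMod 8) = x i) :
    ∃ v ∈ barnesWall 4, ∀ j < 16, ((8 : ℤ) • v) j = d.frameSum t j := by
  obtain ⟨s, hs, v, hv, hvs⟩ := h.code_le_latticeCode hx
  have hdvd : ∀ i, (8 : ℤ) ∣ t i - s i := fun i => by
    have := (ZMod.intCast_zmod_eq_zero_iff_dvd (t i - s i) 8).1 (by simp [ht, hs])
    exact_mod_cast this
  choose m hm using hdvd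
  have hts : t = s + (8 : ℤ) • m := by
    ext i
    simp only [Pi.add_apply, Pi.smul_apply, smul_eq_mul]
    linarith [hm i]
  refine ⟨v + d.frameSum m, add_mem hv (h.frameSum_mem m), fun j hj => ?_⟩
  rw [hts, frameSum_add, frameSum_smul, smul_add, Pi.add_apply, hvs j hj, Pi.add_apply]

lemma sum_mul_eq (h : d.Valid n₃ n₄) {s t : Fin 32 → ℤ} {u v : ℕ → GaussianInt}
    (hu : ∀ j < 16, ((8 : ℤ) • u) j = d.frameSum s j)
    (hv : ∀ j < 16, ((8 : ℤ) • v) j = d.frameSum t j) :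
    ∑ i, s i * t i = 2 * realInner 4 u v := by
  have h1 := h.realInner_frameSum s t
  rw [← realInner_congr (n := 4) hu hv] at h1
  simp only [map_smul, LinearMap.smul_apply, smul_eq_mul] at h1
  omega

lemma eight_dvd_sum_mul (h : d.Valid n₃ n₄) {x y : Fin 32 → ZMod 8} (hx : x ∈ d.code)
    (hy : y ∈ d.code) {s t : Fin 32 → ℤ} (hs : ∀ i, (s i : ZMod 8) = x i)
    (ht : ∀ i, (t i : ZMod 8) = y i) : 8 ∣ ∑ i, s i * t i := by
  obtain ⟨u, hu, hus⟩ := h.exists_lattice_vector hx hs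
  obtain ⟨v, hv, hvt⟩ := h.exists_lattice_vector hy ht
  rw [h.sum_mul_eq hus hvt]
  have := four_dvd_realInner hu hv
  omega

lemma sum_sq (h : d.Valid n₃ n₄) {x : Fin 32 → ZMod 8} (hx : x ∈ d.code)
    {t : Fin 32 → ℤ} (ht : ∀ i, (t i : ZMod 8) = x i) :
    16 ∣ ∑ i, t i ^ 2 ∧ (∑ i, t i ^ 2 ≠ 0 → 32 ≤ ∑ i, t i ^ 2) := by
  obtain ⟨u, hu, hut⟩ := h.exists_lattice_vector hx ht
  simp only [pow_two, h.sum_mul_eq hut hut]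
  have h1 := eight_dvd_realInner_self hu
  have h2 := le_realInner_self hu
  norm_num at h2
  refine ⟨by omega, fun h0 => ?_⟩
  have := h2 (by omega)
  omega

lemma isSelfDual (h : d.Valid n₃ n₄) : IsSelfDual d.code := by
  refine isSelfDual_of_card (fun x hx y hy => ?_) (by rw [h.card_code]; norm_num)
  have h8 := h.eight_dvd_sum_mul hx hy (s := fun i => (x i).valMinAbs)
    (t := fun i => (y i).valMinAbs) (fun i => ZMod.coe_valMinAbs _) (fun i => ZMod.coe_valMinAbs _)
  have h0 := (ZMod.intCast_zmod_eq_zero_iff_dvd _ 8).2 h8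
  push_cast [ZMod.coe_valMinAbs] at h0
  exact h0

lemma sixteen_dvd_euclWt (h : d.Valid n₃ n₄) {x : Fin 32 → ZMod 8} (hx : x ∈ d.code) :
    16 ∣ euclWt x := by
  have h1 := (h.sum_sq hx (t := fun i => (x i).valMinAbs) fun i => ZMod.coe_valMinAbs _).1
  rw [← euclWt_eq] at h1
  exact_mod_cast h1

lemma le_euclWt (h : d.Valid n₃ n₄) {x : Fin 32 → ZMod 8} (hx : x ∈ d.code) (hx0 : x ≠ 0) :
    32 ≤ euclWt x := by
  have h1 := (h.sum_sq hx (t := fun i => (x i).valMinAbs) fun i => ZMod.coe_valMinAbs _).2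
  rw [← euclWt_eq] at h1
  refine Int.ofNat_le.1 (h1 fun h0 => hx0 ?_)
  rw [euclWt_eq, Finset.sum_eq_zero_iff_of_nonneg fun _ _ => sq_nonneg _] at h0
  ext i
  simpa using h0 i (Finset.mem_univ i)

lemma valMinAbs_gen_zero (h : d.Valid n₃ n₄) (i : Fin 32) :
    (d.gen 0 i).valMinAbs = entry d.gens 0 i := by
  have := h.abs_le i i.2
  rw [gen, row_zero, ZMod.valMinAbs_spec]
  refine ⟨rfl, Set.mem_Ioc.2 ⟨?_, ?_⟩⟩ <;> push_cast <;> omega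

lemma euclWt_gen_zero (h : d.Valid n₃ n₄) : euclWt (d.gen 0) = 32 := by
  have h1 := euclWt_eq (d.gen 0)
  simp only [h.valMinAbs_gen_zero] at h1
  have h2 := h.norm_first
  rw [Finset.sum_range] at h2
  exact_mod_cast h1.trans h2

lemma minEuclWtIs (h : d.Valid n₃ n₄) : minEuclWtIs d.code 32 := by
  refine ⟨fun x hx hx0 => h.le_euclWt hx hx0, d.gen 0, d.gen_mem (by norm_num), ?_,
    h.euclWt_gen_zero⟩
  intro h0
  have := h.euclWt_gen_zero
  rw [h0] at this
  simp [euclWt] at this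

lemma xorOn_eq_zero_iff (h : d.Valid n₃ n₄) (S : Finset (Fin 32)) :
    xorOn (fun i : Fin 32 => d.cols.getD i 0) S = 0 ↔
      ∀ k < 17, (∑ i ∈ S, entry d.gens k i) % 2 = 0 := by
  have hb : ∀ k < 17, (xorOn (fun i : Fin 32 => d.cols.getD i 0) S).testBit k =
      decide ((∑ i ∈ S, entry d.gens k i) % 2 = 1) := fun k hk =>
    testBit_xorOn _ (fun i : Fin 32 => entry d.gens k i) k (fun i => h.testBit_cols k hk i i.2) S
  constructor
  · intro h0 k hk
    have := hb k hk
    rw [h0, Nat.zero_testBit, eq_comm, decide_eq_false_iff_not] at this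
    omega
  · intro h0
    refine Nat.zero_of_testBit_eq_false fun k => ?_
    by_cases hk : k < 17
    · rw [hb k hk, h0 k hk]
      rfl
    · exact Nat.testBit_lt_two_pow ((xorOn_lt (fun i : Fin 32 => h.cols_lt i i.2) S).trans_le
        (Nat.pow_le_pow_right (by norm_num) (not_lt.1 hk)))

lemma xorOn_mod_eq_zero_iff (h : d.Valid n₃ n₄) (S : Finset (Fin 32)) :
    xorOn (fun i : Fin 32 => d.cols.getD i 0) S % 2 ^ 15 = 0 ↔
      ∀ k < 15, (∑ i ∈ S, entry d.gens k i) % 2 = 0 := by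
  have hb : ∀ k < 15, (xorOn (fun i : Fin 32 => d.cols.getD i 0) S).testBit k =
      decide ((∑ i ∈ S, entry d.gens k i) % 2 = 1) := fun k hk =>
    testBit_xorOn _ (fun i : Fin 32 => entry d.gens k i) k
      (fun i => h.testBit_cols k (by omega) i i.2) S
  constructor
  · intro h0 k hk
    have := congrArg (Nat.testBit · k) h0
    simp only [Nat.testBit_mod_two_pow, hk, decide_true, Bool.true_and, hb k hk,
      Nat.zero_testBit, decide_eq_false_iff_not] at this
    omega
  · intro h0
    refine Nat.zero_of_testBit_eq_false fun k => ?_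
    rw [Nat.testBit_mod_two_pow]
    by_cases hk : k < 15
    · rw [hb k hk, h0 k hk]
      simp
    · simp [hk]

lemma xorCount_cols (h : d.Valid n₃ n₄) (p : ℕ → Bool) (k : ℕ) :
    xorCount p k d.cols 0 =
      #{S ∈ powersetCard k univ | p (xorOn (fun i : Fin 32 => d.cols.getD i 0) S)} := by
  have hmap : (List.finRange 32).map (fun i : Fin 32 => d.cols.getD i 0) = d.cols := by
    refine List.ext_getElem (by simp [h.cols_length]) fun i h1 h2 => ?_
    simp [h2]
  have := xorCount_map p (fun i : Fin 32 => d.cols.getD i 0) k _ 0 (List.nodup_finRange 32)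
  rw [hmap] at this
  simpa using this

lemma le_hammingWt (h : d.Valid n₃ n₄) {y : Fin 32 → ZMod 2} (hy : y ∈ d.code.map res2)
    (hy0 : y ≠ 0) : 8 ≤ hammingWt y := by
  obtain ⟨x, hx, rfl⟩ := hy
  have hpos : 0 < hammingWt (res2 x) := by
    rw [hammingWt, Finset.card_pos]
    obtain ⟨i, hi⟩ := Function.ne_iff.1 hy0
    exact ⟨i, by simpa using hi⟩
  have hx' := fun i => ZMod.coe_valMinAbs (x i)
  set t : Fin 32 → ℤ := fun i => (x i).valMinAbs with ht
  have h16 : 16 ∣ ∑ i, t i ^ 2 := (h.sum_sq hx hx').1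
  have hcard := hammingWt_res2 x
  have h4 : (4 : ℤ) ∣ ∑ i, t i ^ 2 - #{i | t i % 2 = 1} := by
    rw [Finset.card_filter, Nat.cast_sum, ← Finset.sum_sub_distrib]
    refine Finset.dvd_sum fun i _ => ?_
    rcases Int.even_or_odd' (t i) with ⟨m, hm | hm⟩
    · rw [hm, if_neg (by omega)]
      exact ⟨m ^ 2, by push_cast; ring⟩
    · rw [hm, if_pos (by omega)]
      exact ⟨m ^ 2 + m, by push_cast; ring⟩
  have hne : hammingWt (res2 x) ≠ 4 := by
    intro h0
    have hcount := h.count_min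
    rw [h.xorCount_cols, Finset.card_eq_zero] at hcount
    refine Finset.eq_empty_iff_forall_notMem.1 hcount {i | t i % 2 = 1} ?_
    rw [Finset.mem_filter, Finset.mem_powersetCard_univ, Nat.beq_eq, h.xorOn_eq_zero_iff]
    refine ⟨hcard.symm.trans h0, fun k hk => ?_⟩
    have h8 := h.eight_dvd_sum_mul hx (d.gen_mem hk) hx' (t := d.row k) fun _ => rfl
    have hrow : ∑ i, t i * d.row k i = rowMult k * ∑ i, t i * entry d.gens k i := by
      rw [Finset.mul_sum]
      exact Finset.sum_congr rfl fun i _ => by rw [row]; ring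
    rw [sum_filter_odd_mod_two]
    change 8 ∣ ∑ i, t i * d.row k i at h8
    rw [hrow, rowMult] at h8
    split_ifs at h8 <;> omega
  change hammingWt (res2 x) = #{i | t i % 2 = 1} at hcard
  rw [← hcard] at h4
  omega

lemma hammingWt_gen_zero (h : d.Valid n₃ n₄) : hammingWt (res2 (d.gen 0)) = 8 := by
  rw [hammingWt_res2]
  simp only [h.valMinAbs_gen_zero]
  have h1 := h.weight_first
  rw [Finset.sum_range] at h1
  zify
  rw [← h1, Finset.card_filter, Nat.cast_sum]
  refine Finset.sum_congr rfl fun i _ => ?_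
  split_ifs <;> push_cast <;> omega

lemma finrank_residue (h : d.Valid n₃ n₄) :
    Module.finrank (ZMod 2) (AddSubgroup.toZModSubmodule 2 (d.code.map res2)) = 15 := by
  set b : Fin 15 → Fin 32 → ZMod 2 := fun k i => (entry d.gens k i : ZMod 2) with hb
  have hres : ∀ k < 17, ∀ i, res2 (d.gen k) i = rowMult k * (entry d.gens k i : ZMod 2) := by
    intro k hk i
    have : res2 (d.gen k) i = ((d.row k i : ℤ) : ZMod 2) :=
      map_intCast (ZMod.castHom (by norm_num : 2 ∣ 8) (ZMod 2)) _
    rw [this, row, Int.cast_mul]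
  have hspan : AddSubgroup.toZModSubmodule 2 (d.code.map res2) =
      Submodule.span (ZMod 2) (Set.range b) := by
    refine le_antisymm ?_ (Submodule.span_le.2 ?_)
    · have hle : d.code.map res2 ≤ (Submodule.span (ZMod 2) (Set.range b)).toAddSubgroup := by
        refine AddSubgroup.map_le_iff_le_comap.2 (d.code_le fun k hk => ?_)
        change res2 (d.gen k) ∈ Submodule.span (ZMod 2) (Set.range b)
        by_cases hk15 : k < 15
        · refine Submodule.subset_span ⟨⟨k, hk15⟩, ?_⟩
          ext i
          simp [hres k hk, hb, rowMult, hk15]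
        · have h0 : res2 (d.gen k) = 0 := by
            have h2 : (2 : ZMod 2) = 0 := rfl
            have h4 : (4 : ZMod 2) = 0 := rfl
            ext i
            rw [hres k hk, rowMult]
            split_ifs <;> simp [h2, h4]
          rw [h0]
          exact zero_mem _
      exact fun y hy => hle hy
    · rintro _ ⟨k, rfl⟩
      refine ⟨d.gen k, d.gen_mem (by omega), ?_⟩
      ext i
      simp [hres k (by omega), hb, rowMult]
  have hli : LinearIndependent (ZMod 2) b := by
    refine Fintype.linearIndependent_iff.2 fun g hg j => ?_
    have hj := congrFun hg (Fin.castLE (by norm_num) j)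
    simp only [hb, Finset.sum_apply, Pi.smul_apply, Fin.val_castLE, smul_eq_mul,
      h.pivot _ (Fin.is_lt _) _ j.2, Fin.val_inj] at hj
    simpa using hj
  rw [hspan, finrank_span_eq_card hli, Fintype.card_fin]

lemma fourOn_mem_code_iff (h : d.Valid n₃ n₄) (S : Finset (Fin 32)) :
    fourOn S ∈ d.code ↔ ∀ k < 15, (∑ i ∈ S, entry d.gens k i) % 2 = 0 := by
  have hinner : ∀ k, innerZ (fourOn S) (d.gen k) = 0 ↔
      8 ∣ 4 * (rowMult k * ∑ i ∈ S, entry d.gens k i) := by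
    intro k
    have hz := ZMod.intCast_zmod_eq_zero_iff_dvd
      (4 * (rowMult k * ∑ i ∈ S, entry d.gens k i)) 8
    rw [← Nat.cast_ofNat (R := ℤ), ← hz]
    refine Eq.congr_left ?_
    simp [innerZ, fourOn, gen, row, Finset.mul_sum]
  have hker : fourOn S ∈ d.code ↔ ∀ k < 17, innerZ (fourOn S) (d.gen k) = 0 := by
    rw [h.isSelfDual]
    exact ⟨fun h' k hk => h' _ (d.gen_mem hk),
      fun h' y hy => d.code_le (S := (innerHom (fourOn S)).ker) h' hy⟩
  simp only [hker, hinner]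
  constructor
  · intro h' k hk
    have := h' k (by omega)
    rw [rowMult, if_pos hk] at this
    omega
  · intro h' k hk
    rw [rowMult]
    split_ifs with h1
    · have := h' k h1
      omega
    · omega
    · omega

lemma fourCount_eq (h : d.Valid n₃ n₄) (k : ℕ) :
    fourCount k d.code = xorCount (fun s => Nat.beq (s.mod 32768) 0) k d.cols 0 := by
  classical
  rw [h.xorCount_cols, fourCount]
  refine congrArg Finset.card (Finset.filter_congr fun S _ => ?_)
  rw [h.fourOn_mem_code_iff, ← h.xorOn_mod_eq_zero_iff, Nat.beq_eq]
  rfl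

lemma not_codeEquiv {d' : CodeData} {n₃' n₄' : ℕ} (h : d.Valid n₃ n₄)
    (h' : d'.Valid n₃' n₄') (hne : (n₃, n₄) ≠ (n₃', n₄')) : ¬ codeEquiv d.code d'.code := by
  intro he
  have h3 := fourCount_eq_of_codeEquiv he 3
  have h4 := fourCount_eq_of_codeEquiv he 4
  rw [h.fourCount_eq, h'.fourCount_eq, h.count_three, h'.count_three] at h3
  rw [h.fourCount_eq, h'.fourCount_eq, h.count_four, h'.count_four] at h4
  exact hne (by rw [h3, h4])

end Valid

end CodeData

/-- Ten valid data with distinct invariants give ten codes as required. -/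
lemma exists_codes_of_valid (ds : Fin 10 → CodeData) (n₃ n₄ : Fin 10 → ℕ)
    (h : ∀ j, (ds j).Valid (n₃ j) (n₄ j)) (hne : ∀ j l, j ≠ l → (n₃ j, n₄ j) ≠ (n₃ l, n₄ l)) :
    ∃ Cs : Fin 10 → AddSubgroup (Fin 32 → ZMod 8),
      (∀ j, IsSelfDual (Cs j) ∧ (∀ x ∈ Cs j, 16 ∣ euclWt x) ∧
        minEuclWtIs (Cs j) 32 ∧
        Nonempty ((Cs j) ≃+ ((Fin 15 → ZMod 8) × ZMod 4 × ZMod 2)) ∧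
        Module.finrank (ZMod 2) (AddSubgroup.toZModSubmodule 2 ((Cs j).map res2)) = 15 ∧
        (∀ y ∈ (Cs j).map res2, y ≠ 0 → 8 ≤ hammingWt y) ∧
        (∃ y ∈ (Cs j).map res2, y ≠ 0 ∧ hammingWt y = 8)) ∧
      ∀ j l, j ≠ l → ¬ codeEquiv (Cs j) (Cs l) := by
  refine ⟨fun j => (ds j).code, fun j => ?_, fun j l hjl => (h j).not_codeEquiv (h l) (hne j l hjl)⟩
  refine ⟨(h j).isSelfDual, fun x hx => (h j).sixteen_dvd_euclWt hx, (h j).minEuclWtIs,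
    ⟨(h j).codeEquivProd⟩, (h j).finrank_residue, fun y hy hy0 => (h j).le_hammingWt hy hy0,
    _, ⟨_, (ds j).gen_mem (k := 0) (by norm_num), rfl⟩, fun h0 => ?_, (h j).hammingWt_gen_zero⟩
  have := (h j).hammingWt_gen_zero
  rw [h0] at this
  simp [hammingWt] at this

/-- The data of a code with `fourCount 3 = 0` and `fourCount 4 = 0`. -/
def codeData00 : CodeData where
  frame := [
    224019568506780368963807176107275876217, 160211067240034039858607879365653330057,
    180237453185620880489035226998039480696, 183062714402907026241749328715110123898,
    180149185322187051800758637770288171399, 201422693766879869445547969505458157960,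
    139037247170040008806509662120362674327, 160211110335530075240210706572217186439,
    158887051749257558727741702062840653977, 182730101825562130461817322203159033479,
    181562155748304251772188243484487547304, 161545813323891372546135921308536829798,
    201598888237628046204301607057835530120, 160221148795352648404709781107027511192,
    180139103934650280420381550181903600007, 181561814819576409064923339113207801495,
    184219662179821380168909269179166128520, 204080460157144564868813892199152916872,
    137536349968874981929870867131212007800, 161556197917567499248322797130042935959,
    138948327581642184676588975266806142841, 163035676740397653634487313671548082311,
    205415203537261072134730564014083438727, 182807295493349928595985591912817592201,
    201588195689283977581479032017093363831, 202746709099893646774885937124840282279,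
    204002312186134347310358567037939653015, 178913053829739187089400438893963602071,
    160221146404599010310990475146118728056, 160299378045168209606635864688330041257,
    181484275024369947234995036267186002295, 182730061255463302949934078059653663130]
  gens := [
    204080767076191199605467724619195123849, 205238731827384568696155436720889301144,
    144499135113093831459339298164800260488, 265064963860902516564893267193527572616,
    223764744026440563974480845755631896712, 270366929452988771185574080197313464456,
    177575085609553190602237207211516921992, 266642140858304146442412962689793427592,
    270547479440575142042306533222355863688, 220098089935286640944179811388226046088,
    201609658128764279925898276450259732616, 267955770557923544750250813859270527112,
    120583517031230245228462322586539821192, 182641897578008947686615730919678969992,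
    222792954296178542648529510999312074888, 201344141342274006317725166081583646856,
    202834998508069761368365644528212281480]
  lifts := [
    178826122070037998954788083362934851720, 201422693762219380445392651942485203334,
    137781038146694217865440220335577859975, 160211375363059419820751450050936744344,
    160211372679205414613153560969147361656, 202834633196918048401923037719363488135,
    177578997347888148733969452636257617816, 184142385010788468130122095722734647705,
    140194197488156551830476473089487510153, 206739911159400698762366954239691360439,
    162879604936091837073041355039127992999, 181406694797095417354247639614515345800,
    158886791960734283926988148690540599176, 202679208056913916659421173126140435094,
    140272383790448589115041555022713829528, 206738610555787978224925069813174868360,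
    141616521665084284092409776827964811944]
  cols := [
    1, 2, 4, 8, 16, 32, 64, 128,
    256, 512, 1024, 2048, 4096, 8192, 16384, 44986,
    75886, 13516, 67411, 105897, 122381, 39521, 92754, 42493,
    51880, 52490, 69212, 116288, 46046, 121556, 61289, 103427]

lemma valid_codeData00 : codeData00.Valid 0 0 := by
  constructor <;> decide +kernel

/-- The data of a code with `fourCount 3 = 0` and `fourCount 4 = 1`. -/
def codeData01 : CodeData where
  frame := [
    160222141440337962704050512378064242552, 160376917696484631942471609315685267111,
    180061564273469023950325662214381795463, 158887051749257558727741702062840653977,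
    182817720482909808042692752699251267736, 158974673100984310780757912731657005192,
    181572156322496155176311172767957940616, 160299681097554920881705803971200318104,
    140272648654819865625603264934252681336, 201588195689283977581479032017093363831,
    184131997896953178534165060347610302600, 161545510281410448913074059903243876198,
    160210804767073604332901450612159912041, 160221797823173148194108712765417429639,
    202746365655637785464494669490888878486, 161545510429924577997065552039111137160,
    178748238815467800993819372359313291144, 138860019317086106063149426357160212872,
    178736899755491617479100971150444365945, 183062714402907026241749328715110123898,
    182818328792117390190034040136170703207, 182808633963407381538786999080289204376,
    181395658625765475256445151614771689864, 161389436108925356604517808371619232136,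
    224019265454437029083530941097681914504, 158887051903092230906671252437854689670,
    161545550841566758772441826498193095080, 181473544425465459514920354711007099257,
    182818670033675561506546084548676454281, 137702847075645657752295577755737168007,
    205326976555600213732862155200675743623, 160133183975637532239407518349674387610]
  gens := [
    181307349257005415190915781027596634249, 200445833515625760743044027639979870360,
    229259270659662016199443685645597837704, 164210456712525677443576048374044465288,
    222613046798795345836517038166966372488, 184459384124187597240941187212374476936,
    137469216694670454421827893348216113288, 205237677141783151359238288333559335048,
    120584088921904057842390374461850814600, 162979581676445587580018725735625164936,
    223956994875900412728957926170046269576, 165605295867307192291091393376797886600,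
    221687929245717179597377535641026857096, 157827240070935849067431553932796135560,
    117451858974429648176116326337115359368, 162953252821127467535936474912718882952,
    204169399870153398572112926479886092424]
  lifts := [
    224019224888998851762718102764311316616, 160221490026424446009100936928924502424,
    205405205804760537175434073808678979992, 158710859809155089099954824049228150664,
    159966378908377713300945246164322056824, 158887095165712901116236075158139865719,
    182729753133093161372451923743225707143, 204169379419383874313974014527690873207,
    179983719047179043948208539132112762998, 180238099836562503883443540044553950855,
    206905759240788220925011785865352484778, 160055038560354545226334177868095387783,
    139036597959948776500386904308955130487, 137625610318837789881600819059389794215,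
    225353663014187995925451966303561156999, 180227414888301148296148822049941985383,
    159967758107611527240236931607104551544]
  cols := [
    1, 2, 4, 8, 16, 32, 64, 128,
    256, 512, 1024, 2048, 4096, 8192, 16384, 39054,
    71797, 15012, 85879, 47029, 65855, 86567, 122417, 101896,
    77424, 93599, 60000, 66294, 102908, 126740, 65624, 125834]

lemma valid_codeData01 : codeData01.Valid 0 1 := by
  constructor <;> decide +kernel

/-- The data of a code with `fourCount 3 = 0` and `fourCount 4 = 2`. -/
def codeData02 : CodeData where
  frame := [
    204169379592365523068557389531795982472, 139026821843107769885438379957496089207,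
    180247532507987089255760535887482882456, 178737202803174317203327835603075696791,
    181572845756720641342322034956632102790, 180159910998386866679763666663068170328,
    178748238964057024010246213180146219400, 161379354246636142826930956836808398728,
    181483888459681297100135407783643814297, 140360613306830373578098074859797580182,
    158809171178539098538567930390737561736, 204002617457526160561028641004132604279,
    200009720965160419265779361165160712583, 160123145539663519345782568879022115207,
    204158345947015963325568564376203987080, 161467930222531899889003717147634399097,
    202746363110428077285680323582532016263, 160221797986913465711817964208693803145,
    158964937707491210856900162105841919592, 202835020067375744878336374343377455015,
    180237796788258123464464078490873469065, 178903358678912032168850014784349243511,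
    182807639105890833517349053261106748024, 223931603686446434518397597941120801160,
    202912862604568840171625203546739677321, 202757093688290002777524290624942611081,
    180159529505499730235711230600002701191, 138948976772542929777459618615823665320,
    203914650259687296042742181109289293702, 182906942961810944179900850731582196086,
    180159829873411207811481893107567990936, 160133224545697513530159111795126077833]
  gens := [
    205404474142620861021439691061862107273, 114047697035893610358310264397583911064,
    136056805480791785089785587421376186760, 266548676637555029564232375182056528008,
    143258948415273370067834997623703046280, 142691287897442265886250649906750982280,
    222939228479027869861524348766373054600, 227909556885392819898939160426655025288,
    245535167311852649317050455018554558600, 205409712396200941884034029603711912072,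
    165720727957425166754687060883955812488, 241460837357839183091290983091367610504,
    140045548887887228637732540770333264008, 268231959782178546430190246496226019464,
    226844445230428357934207353434000623752, 201510293419974270129368748638553540744,
    202834998587007781981070376299179575432]
  lifts := [
    181483929033785064144223434222642694280, 161633818852934432226147823767734823046,
    202736019239406407310564766249038358392, 158886748859994755034277919375460300680,
    180326329506778960526532166770501265287, 224019222358940842547951784829526972825,
    182818675103617728326906040437364516743, 137547034902030757176196165434349230763,
    181405699760737645989462490135258499191, 180238407810413690556768503568551937912,
    158898085537960261979500372455004419976, 182807985085992054165248548664742681208,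
    181395312800695631715098186853321967767, 180160562560932825446466589537419635079,
    182730058725439144255465452301736966791, 204003610255069531367472166210710898824,
    157807724754496993818353408566227404679]
  cols := [
    1, 2, 4, 8, 16, 32, 64, 128,
    256, 512, 1024, 2048, 4096, 8192, 16384, 49196,
    93330, 87820, 85300, 83622, 94285, 114797, 8825, 6950,
    114140, 1747, 65586, 107301, 47277, 102884, 47346, 102147]

lemma valid_codeData02 : codeData02.Valid 0 2 := by
  constructor <;> decide +kernel

/-- The data of a code with `fourCount 3 = 0` and `fourCount 4 = 3`. -/
def codeData03 : CodeData where
  frame := [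
    139037247012205222766075992776512207240, 223931603686446434518397597941120801160,
    160133527747251172723201590048005261225, 181483888459681297100135407783643814297,
    180247532507987089255760535887482882456, 225187168432234403506770612436314200184,
    181572845756720641342322034956632102790, 180159529505499730235711230600002701191,
    158721549980688113843475022532493015432, 158876669695543122002078824136696039543,
    182906942961810944179900850731582196086, 182807639105890833517349053261106748024,
    181494619205900810055774907795287603065, 161545164281538616523840046291979176087,
    158809171178539098538567930390737561736, 204158345947015963325568564376203987080,
    202746363110428077285680323582532016263, 158964937707491210856900162105841919592,
    178737202803174317203327835603075696791, 200176523506401339679324950174328523143,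
    200009720965160419265779361165160712583, 184142690608996612901786198884142778504,
    224019571042083987824078345775559050920, 201344461973095109625505638095249766233,
    180237796788258123464464078490873469065, 202912862604568840171625203546739677321,
    202757093688290002777524290624942611081, 160211372817816012831180351389677685112,
    161379354246636142826930956836808398728, 182730099284979053097000209677107697797,
    180159829873411207811481893107567990936, 160133224545697513530159111795126077833]
  gens := [
    204085325552994989514126420681945548937, 156582368211124530614091115948562483352,
    221630385251018038968213244462684998024, 165783031658204216195446433124945795208,
    244108282610650420577419302044493777032, 177661441693493215470213212466939725960,
    144422597132624804718529271734299297928, 182573624361878876969648209172542032008,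
    161363107091013783187671040999989741704, 250519735624836099717003616279140534408,
    227928315817000939699428747041944668296, 225536370662559640444112285780970866824,
    226848990004730684151412937181452863624, 243879840068339334718621419227744602248,
    226933012643809979644419765414195136648, 225276064960923861751530559926767749256,
    204086342050686432349903774357656209544]
  lifts := [
    158808863060256104077019532852495681672, 202747052712354610921642223934190950503,
    158710210772702990525144246883882338453, 180071256739206802591061134587582781031,
    202757134416189757517876168319404972169, 204080846864560116823325098039449389207,
    181728230648197139719260576932623329943, 161623047393379315482402564300680427417,
    198851859121793607362136115956537726841, 201344461824542295431948401438240569241,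
    180237756238624455018789083387266631544, 160211069780655651736068886427353004679,
    198763891628087062867297812028058011767, 182730101815658440068689553966404049065,
    137536306863472715007642872443204831606, 182808249955026244613478879853212563608,
    181318037854716453073861871802149997192]
  cols := [
    1, 2, 4, 8, 16, 32, 64, 128,
    256, 512, 1024, 2048, 4096, 8192, 16384, 54184,
    85778, 22836, 37707, 25583, 73978, 70400, 50793, 51940,
    4582, 32288, 118133, 117284, 95505, 59020, 110003, 74523]

lemma valid_codeData03 : codeData03.Valid 0 3 := by
  constructor <;> decide +kernel

/-- The data of a code with `fourCount 3 = 0` and `fourCount 4 = 4`. -/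
def codeData04 : CodeData where
  frame := [
    222694863399554769439787296697368480137, 180238102371242468136664532413844137880,
    180149488364667975433820499175581124999, 181406692419709113166620376909088323464,
    204169073994159796111629985079976695671, 180071643298688519810548197905264121991,
    181473544425465459514920354711007099257, 160210461308367533330306683612936374136,
    202580209601053860931525188127037094023, 158876323706737937131007213431256877207,
    225431510625949888300001948864637077882, 160299032060404243257977346100757498247,
    201510315118604051977947736175994820471, 181395701726504872517955075159261484936,
    181405702300696775922078004442731878248, 142941183652421121994598276591630452617,
    181396004784129928709362413314299561591, 180082335847615442344191439393068194439,
    158887092318739663404642643912796248426, 182896214764839947784570040299198847111,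
    204080803442866721080516479649457932407, 181561468671192714958478085288461117559,
    201588195689283977581479032017093363831, 205405165254502912443435539265928989046,
    204002312186134347310358567037939653015, 157562652393375997517187837287156189048,
    138870747513440399838813465363758025335, 160387648274924423390280581023306119335,
    181572499772578061683921432109485889416, 160221797833076507984815253203880212583,
    202589945018395510462962401256554465176, 161545164286784216769643162387591231880]
  gens := [
    202845385720956121482193836354400979081, 157792799286211765960668838171263928472,
    245630473384326851911366913358954006920, 159988749372547344238753147298918209672,
    203072544805950785642265279849459976328, 121487608229070068510933436642874656904,
    141876700617483364019243614572208752776, 141923472091404764791466100010456221832,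
    185233800411812958816346974223250000008, 250359445227273667499099314060154931336,
    119357412803678929215954964146727454856, 162865362956518720156920783941426251912,
    229097902141371892454782319111881394312, 117685585466748566882184841685572814984,
    200192690003905991790402868773298669704, 184225825502938256124021918024392542344,
    204086323115445738654948988551579601032]
  lifts := [
    161633432144936168031974825570412824712, 140283725227886200780180334055565850742,
    164292233967435445062433015638286231208, 222861362888416081572516507030372460967,
    180071605263929890721766794114652211576, 201344199331697608657306251045696543095,
    205415546991345793108272536117843625848, 225265397536844747363219630564247636342,
    162879564212818580885067202030318753959, 181327508388462480001419101664430295176,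
    181493967475618660555625260130944525928, 184141773840118772427735698104510805911,
    201509928247488993234852522233560602519, 185466744129288380832120886149344954247,
    160309762792681265740969468477793728152, 161633431991103913740646012559674607750,
    180169646397161832815173936858130716790]
  cols := [
    1, 2, 4, 8, 16, 32, 64, 128,
    256, 512, 1024, 2048, 4096, 8192, 16384, 44850,
    91588, 81282, 112148, 23938, 119815, 52172, 90702, 30271,
    112487, 108828, 25591, 117725, 91810, 54091, 66848, 93759]

lemma valid_codeData04 : codeData04.Valid 0 4 := by
  constructor <;> decide +kernel

/-- The data of a code with `fourCount 3 = 0` and `fourCount 4 = 5`. -/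
def codeData05 : CodeData where
  frame := [
    203992192452783462261352681333912467833, 181650428677097450092621024660593019018,
    158886748860033592402047876913572710521, 158798824609720499091082402517700081559,
    160299337475067134876870006117357758857, 184142387551371706610945626257676138359,
    181473544425465459514920354711007099257, 180149185322187051800758637770288171399,
    182974441474113827921316547539004652184, 181561814819576409064923339113207801495,
    139115132801455233901423881810254272887, 160221148795352648404709781107027511192,
    158876626749218860764069074836549830807, 157562652393375997517187837287156189048,
    160122496507796967069594497765831383160, 180072292335795987781103606614935897976,
    160210804767073604332901450612159912041, 142941183652421121994598276591630452617,
    201510620533266943596840396192595081081, 180071643284161079909696207628020578441,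
    182885522201385585350074808534151231113, 204080803442866721080516479649457932407,
    201588195689283977581479032017093363831, 203993184943356227913199895228012144776,
    204002312186134347310358567037939653015, 181406692424911030927549452263276251257,
    138870747513440399838813465363758025335, 138948979154009599134458854905969338536,
    181572196730097138050859570704192935816, 161545813323891372546135921308536829798,
    181571853280015231543249311362664987016, 160133183975637532239407518349674387610]
  gens := [
    160215936438952247375131732148295862409, 229512650817530890756646798332248230040,
    208311511568230144191452637963007592840, 208241215375772818932452762681950640264,
    241448795924050911198533692147712493704, 161644526455212160785890913827656599688,
    205577161593650450100309097377572620424, 203011901996553726615577534921284552840,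
    183887601342136646278840415562091759752, 242373284633883967980987934986648193160,
    226666726870349533951501550779282000008, 113953218115351647502736294799884191880,
    178976411259336461594007690557507799176, 245441608895993497849904357138263214216,
    160456443901378058880662005762054719624, 222695514907879333902098513037284116616,
    202751921758022429910437988105076639880]
  lifts := [
    184141735978963028739478164564284573832, 205658896688669418413446658588357920647,
    182817679913466530002304674908423616632, 118854789118415093039179573729035843976,
    182729755825656268738897511073815439736, 159052902364747177459219795992358975336,
    164203658307830790807352557196921960328, 140282424776867794568577903398572493191,
    202756447349564574345913571039038310810, 222684519375281119461172670042929014665,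
    158974978520309958133573954335584979560, 204080846711349391446785518760530192501,
    184053811723448149929373699691918104966, 242711167947043946662094513920399406712,
    139036600505117229498999313406248773751, 140195452299134114787295841838001858426,
    117597928680580053925657520652171118985]
  cols := [
    1, 2, 4, 8, 16, 32, 64, 128,
    256, 512, 1024, 2048, 4096, 8192, 16384, 34292,
    80139, 15016, 1339, 2607, 36629, 22340, 39888, 28630,
    50742, 62846, 92803, 113013, 37692, 19364, 34864, 92925]

lemma valid_codeData05 : codeData05.Valid 0 5 := by
  constructor <;> decide +kernel

/-- The data of a code with `fourCount 3 = 0` and `fourCount 4 = 6`. -/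
def codeData06 : CodeData where
  frame := [
    160211413397815621611000129352934848617, 200176520966439650183781186785547749225,
    158799127508889543110586272000223250568, 182651829466958153894921354893678118761,
    181484534961526108568244455275205589399, 160299724187769541000727192758528801400,
    204003264117169632518149981563499551129, 157474768717246761994189589560114649240,
    181562120412505094227578799110507497623, 180071607799269786212301714710995699576,
    202757134257733583051538077728490747529, 204081455336850785857947134965151528840,
    160133833017983205260761278359512058247, 222773398087845505276630235680972765321,
    182730099285639116594222351454602492041, 161711661403419879063476957483860858760,
    181484234453691137561151708952394180712, 182906639765575279177568618431747037319,
    204168730386900778651220418877109795225, 160299337470447739242365350909114414744,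
    182818977987642345857807688397834791305, 202658095261560676391631871222623012777,
    158809168489446737826066964307485616262, 139026516264783896504375347775529326472,
    162880253983102531940288335800175130247, 178914046310408584090252918008591059097,
    161457586020614014277841797645078075289, 203992535900350642540607190232484968823,
    201432732361307789517147959931589597062, 223931300639343565803501535641967499142,
    158731285537259029902237804276652607641, 160221797986253383401512029011321518217]
  gens := [
    160061528841985256717527616672475154569, 249046746121835822625881047170242087064,
    159951418189415980593907969176468228488, 134784735853932117317146754044278642824,
    227772933679942955197214711660877023368, 201571997664747876496775410606581254280,
    268974209446883507951324621449554593928, 221126407095731488156714332439360080008,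
    201345439425737139682461625036202084488, 184329347178099119323430378351194835080,
    136310378610279095671182177658099763336, 262804673550604601888048050546644912264,
    202524393608537567215878394981388945544, 272104395315176002112119761635396585608,
    164208226698040451418773916804792748168, 184064846790610827544230968092218919048,
    181489466201880590314854945779127715976]
  lifts := [
    181483929023881694940912044844616550536, 158897436659268601169156768271752066952,
    159052861794687197347830040455492958602, 163035373693336029509362533559575283576,
    180092374461229024653607376242100038040, 160387953704774970664358074412209379465,
    160133224703532592394208739221993789594, 158975319770567579166840785710924400776,
    140449530192190957635204982811884423047, 161633778129081174358329142297194173847,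
    182896558199772865331176534084705297816, 160388600365034843160493950197961238392,
    180071602727971185106755575582745524359, 182818675113559793224688188269485725850,
    137713190941426857193695677563446802569, 138871052942009786759163391449566377384,
    184065110059530141514532147283505940119]
  cols := [
    1, 2, 4, 8, 16, 32, 64, 128,
    256, 512, 1024, 2048, 4096, 8192, 16384, 52953,
    67034, 30427, 100872, 80637, 86009, 87321, 124556, 17844,
    94538, 41858, 102532, 117049, 123316, 47574, 18746, 20775]

lemma valid_codeData06 : codeData06.Valid 0 6 := by
  constructor <;> decide +kernel

/-- The data of a code with `fourCount 3 = 1` and `fourCount 4 = 0`. -/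
def codeData10 : CodeData where
  frame := [
    161467624639511580263515930325029586570, 180237453338836593273654029261884397705,
    138860362770590241041163986845417573017, 180237756228063127940592252789609367418,
    181484578225346023748286181940555974760, 183061759782157841849870743480090204295,
    184142688053269542842009474351806060921, 202658438864819288345341645591306282887,
    181395009589238452245751256865248418184, 184142425590793072620268255006645987464,
    223941341624524982369297348608542677352, 201499889960067783873795989731202931065,
    222773398241061216879429321359829268647, 161545510424681537315248203086869072025,
    182895909177193130084175701534887610776, 139036860448096724834187219266052925591,
    179983031981172689642632762901955843736, 181483585417239219614571800841717061497,
    160210805083947569351721098002676807817, 180071297304059708738661943947262728327,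
    180160259672284156176655466724538624393, 160299986526702184414660240352058251416,
    180237796629806775771000011898973943945, 182896596233912525065627781861212653432,
    161545164286784065137559435923325089638, 180160219111470030040560825299087366296,
    180237756238585608868994485833191426424, 225275433759709678913517600660827638168,
    137546734557310334054342177491244321142, 205415206231018607030948465250797062040,
    182797905915605893107007816788847659399, 182730061256118691858797986142602361481]
  gens := [
    222689976700921284850417203309871401097, 116704798161445095055888015273425930392,
    265153513242369800696721234226185800072, 271887053777491813075542908937165117576,
    115096216412796116413353568367685503112, 161290738086550185940839277230059718792,
    180305014981459407613728631330114668680, 249113032705094576623666499627669555336,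
    271976556710683764397863848557104629896, 160222776692134280023974635993091836040,
    225108636537238186420516995971544549512, 141607151043877450736605870732773722248,
    245537035997196027530629914910056286344, 248032904605277985037380581906560092296,
    242711857390163359294244182350774175880, 205498345185096286214927754956221483144,
    182818349396373416286426366600616118408]
  lifts := [
    161634081023587159854737991064661559432, 138958368869172251357025298379564418694,
    160143606757326525360997704809765640856, 181396310212696907852148061904019298696,
    202845015562340771791125259486837184664, 180060612193303068073425636456790525816,
    181650388117480170552965758992031193499, 160289642656260485942687174212996004472,
    161378705357467657485220973256700819846, 181494657235382549128221601161003047319,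
    137613930175725899493876479642047051864, 200087988243258465165075305636405221513,
    226511224492449326975678395789762525081, 181395663538569376793118597669602166905,
    182729412387332534721793921845327001737, 160299683469739617768030819827194435704,
    137447776839330923486457540980901255286]
  cols := [
    1, 2, 4, 8, 16, 32, 64, 128,
    256, 512, 1024, 2048, 4096, 8192, 16384, 43388,
    101316, 8182, 76317, 98818, 105483, 28279, 19501, 22992,
    104927, 26744, 2421, 21620, 107240, 62772, 66791, 62130]

lemma valid_codeData10 : codeData10.Valid 1 0 := by
  constructor <;> decide +kernel

/-- The data of a code with `fourCount 3 = 1` and `fourCount 4 = 1`. -/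
def codeData11 : CodeData where
  frame := [
    202834289896044628340902107286267795576, 202668520415436464350208446698284943785,
    204081455336850785857947134965151528840, 180070958762123783732620480402804991896,
    225343240385052073083311433147407108487, 160221454373712488513811894437817129065,
    201432732371830138255095365069485672569, 203992192452162073840059385337233320072,
    160143914711914839255621377487578573191, 181494616680464444250343410633726785431,
    201334688382307011503460715197074213000, 224019570883666357902183617341137000857,
    180071299680868467545709640125195577718, 201334079915297898772477051045331630457,
    202756442269097338743728822593488779911, 161545164440538958209164890355528137130,
    181483928871284953395725791669150783895, 156218211322465819061343992174572312456,
    138870749895564724843835780392174586007, 180071686557265403713527845222595594616,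
    160299378203007973649771094763437066121, 182807984926919185786115964772457937016,
    160122493966599763652563472845154850968, 161457543094135027126678617240180918406,
    180237756069645488537071035146098276489, 181318424556891524379873732948869478297,
    160377569432592353889008144234085579399, 200097988823353616230231778419796318375,
    204246654211530797415047106647475848855, 181405699775922892059310634670901201017,
    203914347217208780262108730905404606071, 162791334552580740181339990101403863433]
  gens := [
    184049229107066330841138012455837403273, 250873197087309015898561164603755628696,
    266544100443005873421234439962877266312, 134970741768277866388919991878709450888,
    225447147190765984998385452781461407880, 114939721216885510720770122831946614920,
    157558755655628367352285901184997820552, 203904592576472905096989537147476805768,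
    117505788396774441361976147055923988616, 163025947444730152239294912584403683464,
    141352098930806098869123256670323509384, 229351063220331014495857652138336880776,
    141689860708239071099802718504703527048, 141540566478278140210219827953683433608,
    181573455507398461113623270055635093640, 202662963104258991925087302901048051848,
    182896233854531951123067298366347577480]
  lifts := [
    181317775683483724389242982457972131976, 182719411965734812754692629874738694008,
    185310934648848436274389426811406219418, 160465534084566585841971899023670937991,
    185466054368907949500743467286486485415, 200098637849894921419176860378396657562,
    138948287170618974585590897105719363752, 181395618224643225333722584396721592744,
    200176826390387083241656303075251951766, 181229505294615947786374118647877044377,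
    161623698806676279448723180983338629527, 205404556777554474453763136723636225912,
    157640881330322845565852811439516452743, 200087644946972545799375978076192609961,
    180070994573216962959549887330982009001, 160133224545692828977051635056664676745,
    140106189424392596191624627329846118279]
  cols := [
    1, 2, 4, 8, 16, 32, 64, 128,
    256, 512, 1024, 2048, 4096, 8192, 16384, 38674,
    82526, 32816, 110470, 40814, 84581, 125889, 98574, 128526,
    85975, 14475, 37419, 45281, 60944, 128051, 65688, 33762]

lemma valid_codeData11 : codeData11.Valid 1 1 := by
  constructor <;> decide +kernel

/-- The data of a code with `fourCount 3 = 1` and `fourCount 4 = 2`. -/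
def codeData12 : CodeData where
  frame := [
    158886705601456717904602956956554533256, 161711966818082780161825336504219113320,
    184142039022063073509148993128128608663, 225431854233211182456471506014078409353,
    180149182955247972868986639149641070232, 180237453186237584361976284385063237767,
    202590940362458752844917284066180962439, 204091188362778582092583456459322845305,
    160299380575189951042337730866807535770, 181385276725803381601962138113224050807,
    139115130276640256043501142683916204407, 202746709258272600511606857676567836807,
    182895565728349334213771326606724867960, 181493970158853705109779656574070524038,
    180149529097847037523630530866993076856, 180160216571544769504796253808086317176,
    184220919704402194903488989353336141704, 201422999186824638564161800070058641559,
    204158343257879920755247185402381503112, 181483969584659241595186728144013265030,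
    202922941763235390992677395383538124696, 182818331490496709606540057232131197351,
    160133183985499807440781114715049322887, 158975362712192966789190023569813969303,
    120256384830642478473496614061682038936, 160055644328942923349728494983283509626,
    205326367929477573672491005498215725176, 180149185476640561773087372588857522296,
    202746403675249863626003710712837871785, 182808287815563009390600351851881204103,
    160211067403150694544190955212336822441, 180237455879419519488137993047766497929]
  gens := [
    160310430695086741156756869237397031049, 245390356138203496700245410285611419800,
    141940406795232499120800234566744312200, 119185713188628926901372022789539141768,
    163940437152762745634289508579378038920, 136440819526825461530049634406439094408,
    262333829841480776290098698360495573128, 250370472539438041273568207244668471432,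
    165710663150188570078731311919466580104, 247762994848408791591637313483730094216,
    220302862433862216113963528220607809672, 229664270776197370503639425124173121672,
    135117960295546363873301901554710251656, 242462666542421513785304821790444914824,
    225425751917075613230777154253718325384, 158897437769141022955426620089886607496,
    202757115327792814855625269136075557000]
  lifts := [
    204158383822699288582154929740643338376, 180237796793501164219924290490634504600,
    161545507735623035339831154120169585062, 204247260147896309190371286865453492407,
    160210723791267293561454379366882048137, 202679553877939701138300703708695521127,
    222850675415955979171932277932018928007, 181649433649982975016726604447743572409,
    119000132874919421236800268947514096040, 202668136391292064872001916318405655162,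
    201510658409608094468817227758633061000, 160133183980256918387817548635820419977,
    180160867986115940661354996150325249895, 181571631510526018428178842967730653303,
    142853261956674983267809830061780465801, 204081149590708674789361034737712929190,
    182807681889100867434112011063137037193]
  cols := [
    1, 2, 4, 8, 16, 32, 64, 128,
    256, 512, 1024, 2048, 4096, 8192, 16384, 33288,
    80938, 16822, 91436, 30884, 24537, 32380, 69205, 83603,
    62923, 66973, 87224, 76174, 84720, 17619, 54360, 107419]

lemma valid_codeData12 : codeData12.Valid 1 2 := by
  constructor <;> decide +kernel

/-- there are ten pairwise inequivalent extremal Type II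
`Z₈`-codes of length `32` and type `(15,1,1)` whose binary residue codes are
optimal `[32,15,8]` binary codes. -/
theorem ten_codes_optimal_residue :
    ∃ Cs : Fin 10 → AddSubgroup (Fin 32 → ZMod 8),
      (∀ j, IsSelfDual (Cs j) ∧ (∀ x ∈ Cs j, 16 ∣ euclWt x) ∧
        minEuclWtIs (Cs j) 32 ∧
        Nonempty ((Cs j) ≃+ ((Fin 15 → ZMod 8) × ZMod 4 × ZMod 2)) ∧
        Module.finrank (ZMod 2) (AddSubgroup.toZModSubmodule 2 ((Cs j).map res2)) = 15 ∧
        (∀ y ∈ (Cs j).map res2, y ≠ 0 → 8 ≤ hammingWt y) ∧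
        (∃ y ∈ (Cs j).map res2, y ≠ 0 ∧ hammingWt y = 8)) ∧
      ∀ j l, j ≠ l → ¬ codeEquiv (Cs j) (Cs l) := by
  refine exists_codes_of_valid ![codeData00, codeData01, codeData02, codeData03, codeData04,
      codeData05, codeData06, codeData10, codeData11, codeData12]
    ![0, 0, 0, 0, 0, 0, 0, 1, 1, 1] ![0, 1, 2, 3, 4, 5, 6, 0, 1, 2] (fun j => ?_) (by decide)
  fin_cases j
  · exact valid_codeData00
  · exact valid_codeData01
  · exact valid_codeData02
  · exact valid_codeData03
  · exact valid_codeData04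
  · exact valid_codeData05
  · exact valid_codeData06
  · exact valid_codeData10
  · exact valid_codeData11
  · exact valid_codeData12
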